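/- Let H be a finite connected simple graph, let G = KB(H), and let q be a vertex of G with degree 2. Then G − {q} is a biclique graph: there exists a finite simple graph H' such that KB(H') is isomorphic to G − {q}. -/

import Mathlib

open SimpleGraph

variable {V : Type}

/-- `B1`, `B2` are the two (nonempty) parts of an induced complete bipartite subgraph:
they are disjoint, each part is independent, and all edges between the parts are present. -/
def IsCBP (H : SimpleGraph V) (B1 B2 : Set V) : Prop :=
  B1.Nonempty ∧ B2.Nonempty ∧ Disjoint B1 B2 ∧
    (∀ a ∈ B1, ∀ b ∈ B1, ¬H.Adj a b) ∧
    (∀ a ∈ B2, ∀ b ∈ B2, ¬H.Adj a b) ∧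
    (∀ a ∈ B1, ∀ b ∈ B2, H.Adj a b)

/-- A set of vertices inducing a complete bipartite subgraph `K_{m,n}`, `m, n ≥ 1`. -/
def IsCompleteBipartiteSet (H : SimpleGraph V) (S : Set V) : Prop :=
  ∃ B1 B2 : Set V, IsCBP H B1 B2 ∧ B1 ∪ B2 = S

/-- A biclique: a maximal set of vertices inducing a complete bipartite subgraph. -/
def IsBiclique (H : SimpleGraph V) (S : Set V) : Prop :=
  IsCompleteBipartiteSet H S ∧
    ∀ T : Set V, IsCompleteBipartiteSet H T → S ⊆ T → S = T

/-- The biclique graph `KB(H)`: the intersection graph of the bicliques of `H`. -/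
def KB (H : SimpleGraph V) : SimpleGraph {S : Set V // IsBiclique H S} :=
  SimpleGraph.fromRel fun A B => (A.1 ∩ B.1).Nonempty


def Concl {V : Type} (H : SimpleGraph V) (q : {S : Set V // IsBiclique H S}) : Prop :=
  ∃ (W : Type) (_ : Fintype W) (H' : SimpleGraph W),
      Nonempty (KB H' ≃g SimpleGraph.induce {p | p ≠ q} (KB H))

theorem concl_mk {V : Type} (H : SimpleGraph V) (q : {S : Set V // IsBiclique H S})
    {W : Type} [Fintype W] (H' : SimpleGraph W) (φ : Set V → Set W)
    (h1 : ∀ B, IsBiclique H B → B ≠ q.1 → IsBiclique H' (φ B))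
    (hinj : ∀ B B', IsBiclique H B → B ≠ q.1 → IsBiclique H B' → B' ≠ q.1 → φ B = φ B' → B = B')
    (hsurj : ∀ T, IsBiclique H' T → ∃ B, IsBiclique H B ∧ B ≠ q.1 ∧ φ B = T)
    (hMeet : ∀ B B', IsBiclique H B → B ≠ q.1 → IsBiclique H B' → B' ≠ q.1 → B ≠ B' →
      ((φ B ∩ φ B').Nonempty ↔ (B ∩ B').Nonempty)) : Concl H q := by
  have hne : ∀ p : {p | p ≠ q}, p.1.1 ≠ q.1 := fun p h => p.2 (Subtype.ext h)
  let f : {p | p ≠ q} → {S : Set W // IsBiclique H' S} :=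
    fun p => ⟨φ p.1.1, h1 _ p.1.2 (hne p)⟩
  have fb : Function.Bijective f := by
    constructor
    · intro a b hab
      have := hinj _ _ a.1.2 (hne a) b.1.2 (hne b) (congrArg Subtype.val hab)
      exact Subtype.ext (Subtype.ext this)
    · rintro ⟨T, hT⟩
      obtain ⟨B, hB, hBq, rfl⟩ := hsurj T hT
      exact ⟨⟨⟨B, hB⟩, fun h => hBq (congrArg Subtype.val h)⟩, rfl⟩
  refine ⟨W, inferInstance, H', ⟨RelIso.symm ⟨Equiv.ofBijective f fb, ?_⟩⟩⟩
  intro a b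
  simp only [Equiv.ofBijective_apply, SimpleGraph.comap_adj, KB, SimpleGraph.fromRel_adj,
    Function.Embedding.subtype_apply]
  have e : f a ≠ f b ↔ a.1 ≠ b.1 := by
    rw [fb.1.ne_iff]; exact not_congr Subtype.ext_iff
  rw [e]
  refine and_congr_right fun hab => ?_
  have hab' : a.1.1 ≠ b.1.1 := fun h => hab (Subtype.ext h)
  exact or_congr (hMeet _ _ a.1.2 (hne a) b.1.2 (hne b) hab')
    (hMeet _ _ b.1.2 (hne b) a.1.2 (hne a) hab'.symm)

theorem exists_biclique {V : Type} [Fintype V] (H : SimpleGraph V) {S : Set V}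
    (h : IsCompleteBipartiteSet H S) : ∃ B, IsBiclique H B ∧ S ⊆ B := by
  obtain ⟨B, hSB, hB⟩ := (Set.toFinite {T | IsCompleteBipartiteSet H T}).exists_le_maximal h
  exact ⟨B, ⟨hB.1, fun T hT hBT => le_antisymm hBT (hB.2 hT hBT)⟩, hSB⟩

theorem IsCBP.symm' {V : Type} {H : SimpleGraph V} {A B : Set V} (h : IsCBP H A B) :
    IsCBP H B A :=
  ⟨h.2.1, h.1, h.2.2.1.symm, h.2.2.2.2.1, h.2.2.2.1, fun a ha b hb => (h.2.2.2.2.2 b hb a ha).symm⟩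

/-- Disjointness is automatic. -/
theorem isCBP_mk {V : Type} {H : SimpleGraph V} {A B : Set V} (hA : A.Nonempty) (hB : B.Nonempty)
    (iA : ∀ a ∈ A, ∀ b ∈ A, ¬H.Adj a b) (iB : ∀ a ∈ B, ∀ b ∈ B, ¬H.Adj a b)
    (hAB : ∀ a ∈ A, ∀ b ∈ B, H.Adj a b) : IsCBP H A B :=
  ⟨hA, hB, Set.disjoint_left.2 fun a ha hb => H.loopless.irrefl a (hAB a ha a hb), iA, iB, hAB⟩

theorem cbp_split {V : Type} {H : SimpleGraph V} {C1 C2 D1 D2 : Set V}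
    (hC : IsCBP H C1 C2) (hD : IsCBP H D1 D2) (h : C1 ∪ C2 ⊆ D1 ∪ D2) :
    (C1 ⊆ D1 ∧ C2 ⊆ D2) ∨ (C1 ⊆ D2 ∧ C2 ⊆ D1) := by
  obtain ⟨⟨c, hc⟩, ⟨d, hd⟩, -, i1, i2, a12⟩ := hC
  obtain ⟨-, -, -, j1, j2, b12⟩ := hD
  have h' : ∀ x, x ∈ C1 ∨ x ∈ C2 → x ∈ D1 ∨ x ∈ D2 := fun x hx => h hx
  have s : ∀ a b, H.Adj a b → H.Adj b a := fun a b h => h.symm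
  rcases h' c (Or.inl hc) with h1 | h1
  · left; constructor <;> intro x hx <;> grind
  · right; constructor <;> intro x hx <;> grind

structure Cfg {V : Type} (H : SimpleGraph V) (X Y P1 P2 R1 R2 : Set V) : Prop where
  q : IsCBP H X Y
  P : IsCBP H P1 P2
  R : IsCBP H R1 R2
  bq : IsBiclique H (X ∪ Y)
  bP : IsBiclique H (P1 ∪ P2)
  bR : IsBiclique H (R1 ∪ R2)
  p1y : ∀ a ∈ P1, a ∉ Y
  p2x : ∀ a ∈ P2, a ∉ X
  r1y : ∀ a ∈ R1, a ∉ Y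
  r2x : ∀ a ∈ R2, a ∉ X
  nPq : P1 ∪ P2 ≠ X ∪ Y
  nRq : R1 ∪ R2 ≠ X ∪ Y
  nPR : P1 ∪ P2 ≠ R1 ∪ R2
  all : ∀ B, IsBiclique H B → (B ∩ (X ∪ Y)).Nonempty → B = X ∪ Y ∨ B = P1 ∪ P2 ∨ B = R1 ∪ R2

namespace Cfg
variable {V : Type} {H : SimpleGraph V} {X Y P1 P2 R1 R2 : Set V}

theorem swap (c : Cfg H X Y P1 P2 R1 R2) : Cfg H X Y R1 R2 P1 P2 :=
  ⟨c.q, c.R, c.P, c.bq, c.bR, c.bP, c.r1y, c.r2x, c.p1y, c.p2x, c.nRq, c.nPq, c.nPR.symm,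
    fun B h1 h2 => by have := c.all B h1 h2; tauto⟩

theorem side (c : Cfg H X Y P1 P2 R1 R2) : Cfg H Y X P2 P1 R2 R1 := by
  obtain ⟨a1, a2, a3, a4, a5, a6, a7, a8, a9, b1, b2, b3, b4, b5⟩ := c
  rw [Set.union_comm X Y, Set.union_comm P1, Set.union_comm R1] at *
  exact ⟨a1.symm', a2.symm', a3.symm', a4, a5, a6, a8, a7, b1, a9, b2, b3, b4, b5⟩

theorem L [Fintype V] (c : Cfg H X Y P1 P2 R1 R2) {C1 C2 : Set V} (hC : IsCBP H C1 C2)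
    (h : ∃ a, (a ∈ C1 ∧ a ∈ X) ∨ (a ∈ C2 ∧ a ∈ Y)) :
    (C1 ⊆ X ∧ C2 ⊆ Y) ∨ (C1 ⊆ P1 ∧ C2 ⊆ P2) ∨ (C1 ⊆ R1 ∧ C2 ⊆ R2) := by
  obtain ⟨B, hB, hCB⟩ := exists_biclique H ⟨C1, C2, hC, rfl⟩
  obtain ⟨a, ha⟩ := h
  have hd := c.q.2.2.1
  rw [Set.disjoint_left] at hd
  have hm : (B ∩ (X ∪ Y)).Nonempty := by
    refine ⟨a, hCB ?_, ?_⟩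
    · rcases ha with ha | ha
      · exact Or.inl ha.1
      · exact Or.inr ha.1
    · rcases ha with ha | ha
      · exact Or.inl ha.2
      · exact Or.inr ha.2
  have e1 := c.p1y
  have e2 := c.p2x
  have e3 := c.r1y
  have e4 := c.r2x
  rcases c.all B hB hm with rfl | rfl | rfl
  · rcases cbp_split hC c.q hCB with h | h
    · exact Or.inl h
    · exfalso
      rcases ha with ha | ha
      · exact hd ha.2 (h.1 ha.1)
      · exact hd (h.2 ha.1) ha.2
  · rcases cbp_split hC c.P hCB with h | h
    · exact Or.inr (Or.inl h)
    · exfalso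
      rcases ha with ha | ha
      · exact e2 a (h.1 ha.1) ha.2
      · exact e1 a (h.2 ha.1) ha.2
  · rcases cbp_split hC c.R hCB with h | h
    · exact Or.inr (Or.inr h)
    · exfalso
      rcases ha with ha | ha
      · exact e4 a (h.1 ha.1) ha.2
      · exact e3 a (h.2 ha.1) ha.2

theorem E [Fintype V] (c : Cfg H X Y P1 P2 R1 R2) (a b : V) (hab : H.Adj a b)
    (h : a ∈ X ∨ b ∈ Y) : (a ∈ X ∧ b ∈ Y) ∨ (a ∈ P1 ∧ b ∈ P2) ∨ (a ∈ R1 ∧ b ∈ R2) := by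
  have hC : IsCBP H {a} {b} := isCBP_mk (by simp) (by simp) (by simp) (by simp) (by simpa)
  have := c.L hC (by rcases h with h | h; exacts [⟨a, by simp [h]⟩, ⟨b, by simp [h]⟩])
  simpa using this

/-- induced path `a - b - d` with middle vertex on the second side -/
theorem T [Fintype V] (c : Cfg H X Y P1 P2 R1 R2) (a b d : V) (hab : H.Adj a b) (hdb : H.Adj d b)
    (had : ¬ H.Adj a d) (h : a ∈ X ∨ b ∈ Y) :
    (a ∈ X ∧ b ∈ Y ∧ d ∈ X) ∨ (a ∈ P1 ∧ b ∈ P2 ∧ d ∈ P1) ∨ (a ∈ R1 ∧ b ∈ R2 ∧ d ∈ R1) := by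
  have hC : IsCBP H {a, d} {b} := isCBP_mk (by simp) (by simp)
    (by simp [had, mt (fun h : H.Adj d a => h.symm) had]) (by simp) (by simp [hab, hdb])
  have := c.L hC (by rcases h with h | h; exacts [⟨a, by simp [h]⟩, ⟨b, by simp [h]⟩])
  simp [Set.insert_subset_iff] at this
  tauto

/-- maximality of a biclique: a vertex complete to side 2 and without neighbours in side 1 -/
theorem _root_.biclique_ext {A B : Set V} (h : IsBiclique H (A ∪ B)) (hAB : IsCBP H A B) (t : V)
    (h1 : ∀ a ∈ A, ¬ H.Adj t a) (h2 : ∀ b ∈ B, H.Adj t b) : t ∈ A := by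
  have hC : IsCBP H (insert t A) B := by
    obtain ⟨a1, a2, -, a4, a5, a6⟩ := hAB
    refine isCBP_mk (by simp) a2 ?_ a5 ?_
    · rintro a (rfl | ha) b (rfl | hb)
      · simp
      · exact h1 b hb
      · exact fun h => h1 a ha h.symm
      · exact a4 a ha b hb
    · rintro a (rfl | ha) b hb
      · exact h2 b hb
      · exact a6 a ha b hb
  have := h.2 _ ⟨_, _, hC, rfl⟩ (Set.union_subset_union_left _ (Set.subset_insert _ _))
  have ht : t ∈ A ∪ B := by rw [this]; simp
  rcases ht with ht | ht
  · exact ht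
  · exact absurd (h2 t ht) (H.loopless.irrefl t)

end Cfg

/-- The path on four vertices. -/
def path4 : SimpleGraph (Fin 4) where
  Adj a b := a.val + 1 = b.val ∨ b.val + 1 = a.val
  symm := ⟨fun a b h => h.symm⟩
  loopless := ⟨fun a h => by omega⟩

theorem path4_cb (T : Set (Fin 4)) (h : IsCompleteBipartiteSet path4 T) :
    T ⊆ {0, 1, 2} ∨ T ⊆ {1, 2, 3} := by
  by_contra hcon
  rw [not_or, Set.not_subset, Set.not_subset] at hcon
  obtain ⟨⟨a, ha, ha'⟩, ⟨b, hb, hb'⟩⟩ := hcon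
  have ea : a = 3 := by fin_cases a <;> simp_all
  have eb : b = 0 := by fin_cases b <;> simp_all
  subst ea eb
  obtain ⟨C1, C2, ⟨⟨c, hc⟩, ⟨d, hd⟩, -, i1, i2, h12⟩, rfl⟩ := h
  simp only [path4] at *
  rcases ha with ha | ha <;> rcases hb with hb | hb
  · have h1 := h12 _ ha _ hd
    have h2 := h12 _ hb _ hd
    simp at h1 h2; omega
  · have h1 := h12 _ ha _ hb
    simp at h1
  · have h1 := h12 _ hb _ ha
    simp at h1
  · have h1 := h12 _ hc _ ha
    have h2 := h12 _ hc _ hb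
    simp at h1 h2; omega

theorem path4_biclique (T : Set (Fin 4)) :
    IsBiclique path4 T ↔ T = {0, 1, 2} ∨ T = {1, 2, 3} := by
  have c1 : IsCompleteBipartiteSet path4 {0, 1, 2} := by
    refine ⟨{0, 2}, {1}, isCBP_mk (by simp) (by simp) (by simp [path4]) (by simp)
      (by simp [path4]), ?_⟩
    ext x; simp; tauto
  have c2 : IsCompleteBipartiteSet path4 {1, 2, 3} := by
    refine ⟨{1, 3}, {2}, isCBP_mk (by simp) (by simp) (by simp [path4]) (by simp)
      (by simp [path4]), ?_⟩
    ext x; simp; tauto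
  constructor
  · intro h
    rcases path4_cb T h.1 with h1 | h1
    · exact Or.inl (h.2 _ c1 h1)
    · exact Or.inr (h.2 _ c2 h1)
  · rintro (rfl | rfl)
    · refine ⟨c1, fun T hT h => ?_⟩
      rcases path4_cb T hT with h1 | h1
      · exact le_antisymm h h1
      · have := h1 (h (show (0 : Fin 4) ∈ _ by simp))
        simp at this
    · refine ⟨c2, fun T hT h => ?_⟩
      rcases path4_cb T hT with h1 | h1
      · have := h1 (h (show (3 : Fin 4) ∈ _ by simp))
        simp at this
      · exact le_antisymm h h1

namespace Cfg
variable {V : Type} {H : SimpleGraph V} {X Y P1 P2 R1 R2 : Set V}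

open Classical in
theorem K3 (c : Cfg H X Y P1 P2 R1 R2) (q : {S : Set V // IsBiclique H S}) (hq : q.1 = X ∪ Y)
    (hall : ∀ B, IsBiclique H B → B = X ∪ Y ∨ B = P1 ∪ P2 ∨ B = R1 ∪ R2)
    (hPR : ((P1 ∪ P2) ∩ (R1 ∪ R2)).Nonempty) : Concl H q := by
  have hne : ({0, 1, 2} : Set (Fin 4)) ≠ {1, 2, 3} := by
    intro h
    have : (0 : Fin 4) ∈ ({1, 2, 3} : Set (Fin 4)) := by rw [← h]; simp
    simp at this
  have hall' : ∀ B, IsBiclique H B → B ≠ q.1 → B = P1 ∪ P2 ∨ B = R1 ∪ R2 := by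
    intro B hB hBq
    rw [hq] at hBq
    have := hall B hB
    tauto
  have hn := c.nPR
  have hn' := c.nPR.symm
  refine concl_mk H q path4 (fun B => if B = P1 ∪ P2 then {0, 1, 2} else {1, 2, 3}) ?_ ?_ ?_ ?_
  · intro B hB hBq
    rw [path4_biclique]
    split_ifs <;> simp
  · intro B B' hB hBq hB' hBq' h
    rcases hall' B hB hBq with rfl | rfl <;> rcases hall' B' hB' hBq' with rfl | rfl
    · rfl
    · simp only [if_true, if_neg hn'] at h; exact absurd h hne
    · simp only [if_true, if_neg hn'] at h; exact absurd h.symm hne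
    · rfl
  · intro T hT
    rcases (path4_biclique T).1 hT with rfl | rfl
    · exact ⟨P1 ∪ P2, c.bP, hq ▸ c.nPq, by simp⟩
    · exact ⟨R1 ∪ R2, c.bR, hq ▸ c.nRq, by simp [hn']⟩
  · intro B B' hB hBq hB' hBq' h
    have l1 : (B ∩ B').Nonempty := by
      rcases hall' B hB hBq with rfl | rfl <;> rcases hall' B' hB' hBq' with rfl | rfl
      · exact absurd rfl h
      · exact hPR
      · rw [Set.inter_comm]; exact hPR
      · exact absurd rfl h
    refine iff_of_true ⟨1, ?_⟩ l1
    constructor <;> split_ifs <;> simp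

/-- Delete all edges that lie in `q` only. -/
def delGraph (H : SimpleGraph V) (X Y P1 P2 R1 R2 : Set V) : SimpleGraph V where
  Adj a b := H.Adj a b ∧ ¬ (a ∈ X ∧ b ∈ Y ∧ ¬ (a ∈ P1 ∧ b ∈ P2) ∧ ¬ (a ∈ R1 ∧ b ∈ R2)) ∧
    ¬ (b ∈ X ∧ a ∈ Y ∧ ¬ (b ∈ P1 ∧ a ∈ P2) ∧ ¬ (b ∈ R1 ∧ a ∈ R2))
  symm := ⟨fun _ _ h => ⟨h.1.symm, h.2.2, h.2.1⟩⟩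
  loopless := ⟨fun a h => H.loopless.irrefl a h.1⟩

theorem caseI [Fintype V] (c : Cfg H X Y P1 P2 R1 R2) (q : {S : Set V // IsBiclique H S})
    (hq : q.1 = X ∪ Y)
    (h3 : ∀ v ∈ X, v ∈ P1 → v ∉ R1 → ∀ w ∈ Y, w ∈ R2 → w ∉ P2 → ∀ u ∈ P2, u ∉ R1)
    (h3' : ∀ v ∈ X, v ∈ R1 → v ∉ P1 → ∀ w ∈ Y, w ∈ P2 → w ∉ R2 → ∀ u ∈ R2, u ∉ P1)
    (h2 : ∀ v ∈ X, v ∈ P1 → v ∉ R1 → ∀ w ∈ X, w ∈ R1 → w ∉ P1 → ∀ y ∈ Y, y ∈ P2 → y ∉ R2)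
    (h2' : ∀ v ∈ Y, v ∈ P2 → v ∉ R2 → ∀ w ∈ Y, w ∈ R2 → w ∉ P2 → ∀ y ∈ X, y ∈ P1 → y ∉ R1) :
    Concl H q := by
  have cE := c.E
  have dP := Set.disjoint_left.1 c.P.2.2.1
  have dR := Set.disjoint_left.1 c.R.2.2.1
  have iX := c.q.2.2.2.1
  have iY := c.q.2.2.2.2.1
  have sy : ∀ a b, H.Adj a b → H.Adj b a := fun a b h => h.symm
  -- adjacent in H, same side in H'
  have key : ∀ a b d, (delGraph H X Y P1 P2 R1 R2).Adj a d → (delGraph H X Y P1 P2 R1 R2).Adj b d →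
      H.Adj a b → (delGraph H X Y P1 P2 R1 R2).Adj a b := by
    have key0 : ∀ a b d, H.Adj a d → H.Adj b d → H.Adj a b →
        (a ∈ X ∧ b ∈ Y ∧ ¬ (a ∈ P1 ∧ b ∈ P2) ∧ ¬ (a ∈ R1 ∧ b ∈ R2)) → False := by
      intro a b d had hbd hab h
      have e1 := cE a d had (Or.inl h.1)
      have e2 := cE d b hbd.symm (Or.inr h.2.1)
      grind
    intro a b d had hbd hab
    exact ⟨hab, key0 a b d had.1 hbd.1 hab, key0 b a d hbd.1 had.1 hab.symm⟩
  have toH : ∀ C1 C2, IsCBP (delGraph H X Y P1 P2 R1 R2) C1 C2 → IsCBP H C1 C2 := by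
    rintro C1 C2 ⟨⟨x, hx⟩, ⟨y, hy⟩, -, i1, i2, h12⟩
    refine isCBP_mk ⟨x, hx⟩ ⟨y, hy⟩ ?_ ?_ fun a ha b hb => (h12 a ha b hb).1
    · intro a ha b hb hab
      exact i1 a ha b hb (key a b y (h12 a ha y hy) (h12 b hb y hy) hab)
    · intro a ha b hb hab
      exact i2 a ha b hb (key a b x (h12 x hx a ha).symm (h12 x hx b hb).symm hab)
  have ofH : ∀ B, IsBiclique H B → B ≠ X ∪ Y →
      IsCompleteBipartiteSet (delGraph H X Y P1 P2 R1 R2) B := by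
    have aux : ∀ C1 C2, IsCBP H C1 C2 → IsBiclique H (C1 ∪ C2) → C1 ∪ C2 ≠ X ∪ Y →
        ∀ a ∈ C1, ∀ b ∈ C2,
          ¬ (a ∈ X ∧ b ∈ Y ∧ ¬ (a ∈ P1 ∧ b ∈ P2) ∧ ¬ (a ∈ R1 ∧ b ∈ R2)) := by
      rintro C1 C2 hC hB hne a ha b hb ⟨hax, -, n1, n2⟩
      rcases c.L hC ⟨a, Or.inl ⟨ha, hax⟩⟩ with h | h | h
      · exact hne (hB.2 _ c.bq.1 (Set.union_subset_union h.1 h.2))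
      · exact n1 ⟨h.1 ha, h.2 hb⟩
      · exact n2 ⟨h.1 ha, h.2 hb⟩
    rintro B hB hne
    obtain ⟨C1, C2, hC, rfl⟩ := hB.1
    refine ⟨C1, C2, isCBP_mk hC.1 hC.2.1 (fun a ha b hb h => hC.2.2.2.1 a ha b hb h.1)
      (fun a ha b hb h => hC.2.2.2.2.1 a ha b hb h.1) ?_, rfl⟩
    intro a ha b hb
    refine ⟨hC.2.2.2.2.2 a ha b hb, aux C1 C2 hC hB hne a ha b hb, ?_⟩
    exact aux C2 C1 hC.symm' (by rwa [Set.union_comm]) (by rwa [Set.union_comm]) b hb a ha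
  refine concl_mk H q (delGraph H X Y P1 P2 R1 R2) id ?_ (fun _ _ _ _ _ _ h => h) ?_
    (fun _ _ _ _ _ _ _ => Iff.rfl)
  · intro B hB hBq
    rw [hq] at hBq
    refine ⟨ofH B hB hBq, ?_⟩
    rintro T ⟨C1, C2, hC, rfl⟩ hT
    exact hB.2 _ ⟨C1, C2, toH _ _ hC, rfl⟩ hT
  · rintro T hT
    have fin : ∀ B, IsBiclique H B → B ≠ X ∪ Y → T ⊆ B →
        ∃ B, IsBiclique H B ∧ B ≠ q.1 ∧ id B = T := fun B hB hne hTB =>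
      ⟨B, hB, hq ▸ hne, (hT.2 _ (ofH B hB hne) hTB).symm⟩
    have aux : ∀ C1 C2, IsCBP (delGraph H X Y P1 P2 R1 R2) C1 C2 → C1 ⊆ X → C2 ⊆ Y →
        (C1 ⊆ P1 ∧ C2 ⊆ P2) ∨ (C1 ⊆ R1 ∧ C2 ⊆ R2) := by
      rintro C1 C2 ⟨⟨x, hx⟩, ⟨y, hy⟩, -, -, -, h12⟩ hX hY
      have hh : ∀ a ∈ C1, ∀ b ∈ C2, (a ∈ P1 ∧ b ∈ P2) ∨ (a ∈ R1 ∧ b ∈ R2) := by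
        intro a ha b hb
        have := (h12 a ha b hb).2.1
        have := hX ha
        have := hY hb
        tauto
      have hX' : ∀ a ∈ C1, a ∈ X := fun a h => hX h
      have hY' : ∀ a ∈ C2, a ∈ Y := fun a h => hY h
      by_contra hcon
      rw [not_or, not_and_or, not_and_or, Set.not_subset, Set.not_subset, Set.not_subset,
        Set.not_subset] at hcon
      obtain ⟨⟨s, hs, hs'⟩ | ⟨s, hs, hs'⟩, ⟨t, ht, ht'⟩ | ⟨t, ht, ht'⟩⟩ := hcon
      · have := hh s hs y hy
        have := hh t ht y hy
        grind
      · have := hh s hs t ht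
        grind
      · have := hh t ht s hs
        grind
      · have := hh x hx s hs
        have := hh x hx t ht
        grind
    obtain ⟨C1, C2, hC, hCT⟩ := hT.1
    obtain ⟨B, hB, hTB⟩ := exists_biclique H ⟨C1, C2, toH _ _ hC, rfl⟩
    by_cases hBq : B = X ∪ Y
    · subst hBq
      have hcase : (C1 ⊆ P1 ∧ C2 ⊆ P2) ∨ (C1 ⊆ R1 ∧ C2 ⊆ R2) ∨
          (C2 ⊆ P1 ∧ C1 ⊆ P2) ∨ (C2 ⊆ R1 ∧ C1 ⊆ R2) := by
        rcases cbp_split (toH _ _ hC) c.q hTB with h | h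
        · have := aux C1 C2 hC h.1 h.2
          tauto
        · have := aux C2 C1 hC.symm' h.2 h.1
          tauto
      rcases hcase with h | h | h | h
      · exact fin _ c.bP c.nPq (hCT ▸ Set.union_subset_union h.1 h.2)
      · exact fin _ c.bR c.nRq (hCT ▸ Set.union_subset_union h.1 h.2)
      · exact fin _ c.bP c.nPq (hCT ▸ Set.union_comm C2 C1 ▸ Set.union_subset_union h.1 h.2)
      · exact fin _ c.bR c.nRq (hCT ▸ Set.union_comm C2 C1 ▸ Set.union_subset_union h.1 h.2)
    · exact fin B hB hBq (hCT ▸ hTB)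

end Cfg

theorem closed_univ {V : Type} {H : SimpleGraph V} (hconn : H.Connected) (C : Set V) (x : V)
    (hx : x ∈ C) (hcl : ∀ a ∈ C, ∀ b, H.Adj a b → b ∈ C) : ∀ v, v ∈ C := by
  intro v
  obtain ⟨w⟩ := hconn.preconnected x v
  induction w with
  | nil => exact hx
  | cons h _ ih => exact ih (hcl _ hx _ h)

namespace Cfg
variable {V : Type} {H : SimpleGraph V} {X Y P1 P2 R1 R2 : Set V}

theorem K3' (c : Cfg H X Y P1 P2 R1 R2) (q : {S : Set V // IsBiclique H S}) (hq : q.1 = X ∪ Y)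
    (hall : ∀ a b, H.Adj a b → a ∈ X ∨ a ∈ Y ∨ b ∈ X ∨ b ∈ Y)
    (hPR : ((P1 ∪ P2) ∩ (R1 ∪ R2)).Nonempty) : Concl H q := by
  refine c.K3 q hq (fun B hB => c.all B hB ?_) hPR
  obtain ⟨C1, C2, ⟨⟨a, ha⟩, ⟨b, hb⟩, -, -, -, h12⟩, rfl⟩ := hB.1
  rcases hall a b (h12 a ha b hb) with h | h | h | h
  · exact ⟨a, Or.inl ha, Or.inl h⟩
  · exact ⟨a, Or.inl ha, Or.inr h⟩
  · exact ⟨b, Or.inr hb, Or.inl h⟩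
  · exact ⟨b, Or.inr hb, Or.inr h⟩

theorem caseII [Fintype V] (c : Cfg H X Y P1 P2 R1 R2) (q : {S : Set V // IsBiclique H S})
    (hconn : H.Connected) (hq : q.1 = X ∪ Y) (v w y : V)
    (vX : v ∈ X) (vP : v ∈ P1) (vR : v ∉ R1) (wX : w ∈ X) (wR : w ∈ R1) (wP : w ∉ P1)
    (yY : y ∈ Y) (yP : y ∈ P2) (yR : y ∈ R2) : Concl H q := by
  have cE := c.E
  have cT := c.T
  have dP := Set.disjoint_left.1 c.P.2.2.1
  have dR := Set.disjoint_left.1 c.R.2.2.1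
  have dq := Set.disjoint_left.1 c.q.2.2.1
  obtain ⟨-, -, -, iX, iY, aq⟩ := c.q
  obtain ⟨-, -, -, iP1, iP2, aP⟩ := c.P
  obtain ⟨-, -, -, iR1, iR2, aR⟩ := c.R
  have sy : ∀ a b, H.Adj a b → H.Adj b a := fun a b h => h.symm
  have p1y := c.p1y
  have p2x := c.p2x
  have r1y := c.r1y
  have r2x := c.r2x
  have n1 : ∀ t ∈ P2, t ∉ R1 := fun t h1 h2 => iP2 _ h1 _ yP (aR _ h2 _ yR)
  have n2 : ∀ t ∈ P1, t ∉ R2 := fun t h1 h2 => iR2 _ h2 _ yR (aP _ h1 _ yP)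
  have f1 : ∀ t ∈ P1, ¬ H.Adj w t := by
    intro t ht h
    have := cE w t h (Or.inl wX)
    grind
  have f2 : ∀ t ∈ R1, ¬ H.Adj v t := by
    intro t ht h
    have := cE v t h (Or.inl vX)
    grind
  obtain ⟨b, hb, hwb⟩ : ∃ b ∈ P2, ¬ H.Adj w b := by
    by_contra hcon
    push Not at hcon
    exact wP (biclique_ext c.bP c.P w f1 hcon)
  obtain ⟨d, hd, hvd⟩ : ∃ b ∈ R2, ¬ H.Adj v b := by
    by_contra hcon
    push Not at hcon
    exact vR (biclique_ext c.bR c.R v f2 hcon)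
  have hbY : b ∉ Y := fun h => hwb (aq _ wX _ h)
  have hbR : b ∉ R2 := fun h => hwb (aR _ wR _ h)
  have hdY : d ∉ Y := fun h => hvd (aq _ vX _ h)
  have hdP : d ∉ P2 := fun h => hvd (aP _ vP _ h)
  have hbd : ¬ H.Adj b d := by
    intro h
    have := cT v b d (aP _ vP _ hb) h.symm hvd (Or.inl vX)
    grind
  have n3 : ∀ m ∈ P1, m ∉ R1 := by
    intro m h1 h2
    have hC : IsCBP H {m} {y, b, d} := by
      refine isCBP_mk (by simp) (by simp) (by simp) ?_ ?_
      · have e1 := iP2 _ yP _ hb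
        have e2 := iR2 _ yR _ hd
        have e3 := iP2 _ hb _ yP
        have e4 := iR2 _ hd _ yR
        have e5 : ¬ H.Adj d b := fun h => hbd h.symm
        simp [e1, e2, e3, e4, e5, hbd]
      · simp [aP _ h1 _ yP, aP _ h1 _ hb, aR _ h2 _ hd]
    have := c.L hC ⟨y, Or.inr ⟨by simp, yY⟩⟩
    simp [Set.insert_subset_iff, hbY, hdP, hbR] at this
  have P1X : ∀ t ∈ P1, t ∈ X := by
    intro t ht
    have := cT w y t (aq _ wX _ yY) (aP _ ht _ yP) (f1 t ht) (Or.inl wX)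
    grind
  have R1X : ∀ t ∈ R1, t ∈ X := by
    intro t ht
    have := cT v y t (aq _ vX _ yY) (aR _ ht _ yR) (f2 t ht) (Or.inl vX)
    grind
  have g1 : ∀ t ∈ P2, t ∉ Y → ∀ s, H.Adj t s → s ∈ P1 := by
    intro t ht htY s hts
    by_cases hvs : H.Adj v s
    · have := cE v s hvs (Or.inl vX)
      have := fun h => cE t s hts (Or.inr h)
      grind
    · have := cT v t s (aP _ vP _ ht) hts.symm hvs (Or.inl vX)
      grind
  have g2 : ∀ t ∈ R2, t ∉ Y → ∀ s, H.Adj t s → s ∈ R1 := by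
    intro t ht htY s hts
    by_cases hvs : H.Adj w s
    · have := cE w s hvs (Or.inl wX)
      have := fun h => cE t s hts (Or.inr h)
      grind
    · have := cT w t s (aR _ wR _ ht) hts.symm hvs (Or.inl wX)
      grind
  have hC := closed_univ hconn {t | t ∈ X ∨ t ∈ Y ∨ t ∈ P2 ∨ t ∈ R2} v (Or.inl vX) (by
    rintro a ha b hab
    simp only [Set.mem_ofPred_eq] at ha ⊢
    have := fun h => cE a b hab (Or.inl h)
    have := fun h => cE b a hab.symm (Or.inr h)
    grind)
  simp only [Set.mem_ofPred_eq] at hC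
  refine c.K3' q hq ?_ ⟨y, Or.inr yP, Or.inr yR⟩
  intro a b hab
  have := hC a
  grind

theorem caseIII_facts [Fintype V] (c : Cfg H X Y P1 P2 R1 R2) (v w u : V)
    (vX : v ∈ X) (vP : v ∈ P1) (vR : v ∉ R1) (wY : w ∈ Y) (wR : w ∈ R2) (wP : w ∉ P2)
    (uP : u ∈ P2) (uR : u ∈ R1) :
    (∀ t ∈ P2, t ∉ Y → ∀ s, H.Adj t s → s ∈ P1 ∨ (s ∈ Y ∧ s ∈ R2 ∧ s ∉ P2 ∧ t ∈ R1)) ∧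
    (∀ t ∈ R1, t ∉ X → ∀ s, H.Adj t s → s ∈ R2 ∨ (s ∈ X ∧ s ∈ P1 ∧ s ∉ R1 ∧ t ∈ P2)) ∧
    (∀ t ∈ P1, t ∈ R2 ∨ (t ∈ X ∧ t ∉ R1)) ∧
    (∀ t ∈ R2, t ∈ P1 ∨ (t ∈ Y ∧ t ∉ P2)) ∧ u ∉ X ∧ u ∉ Y := by
  have cE := c.E
  have cT := c.T
  have cT' := c.side.T
  have dP := Set.disjoint_left.1 c.P.2.2.1
  have dR := Set.disjoint_left.1 c.R.2.2.1
  have dq := Set.disjoint_left.1 c.q.2.2.1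
  obtain ⟨-, -, -, iX, iY, aq⟩ := c.q
  obtain ⟨-, -, -, iP1, iP2, aP⟩ := c.P
  obtain ⟨-, -, -, iR1, iR2, aR⟩ := c.R
  have sy : ∀ a b, H.Adj a b → H.Adj b a := fun a b h => h.symm
  have p1y := c.p1y
  have p2x := c.p2x
  have r1y := c.r1y
  have r2x := c.r2x
  have uX := p2x u uP
  have uY := r1y u uR
  have g1 : ∀ t ∈ P2, t ∉ Y → ∀ s, H.Adj t s →
      s ∈ P1 ∨ (s ∈ Y ∧ s ∈ R2 ∧ s ∉ P2 ∧ t ∈ R1) := by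
    intro t ht htY s hts
    by_cases hvs : H.Adj v s
    · have := cE v s hvs (Or.inl vX)
      have := fun h => cE t s hts (Or.inr h)
      grind
    · have := cT v t s (aP _ vP _ ht) hts.symm hvs (Or.inl vX)
      grind
  have g2 : ∀ t ∈ R1, t ∉ X → ∀ s, H.Adj t s →
      s ∈ R2 ∨ (s ∈ X ∧ s ∈ P1 ∧ s ∉ R1 ∧ t ∈ P2) := by
    intro t ht htX s hts
    by_cases hvs : H.Adj w s
    · have := cE s w hvs.symm (Or.inr wY)
      have := fun h => cE s t hts.symm (Or.inl h)
      grind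
    · have := cT' w t s (aR _ ht _ wR).symm hts.symm hvs (Or.inl wY)
      grind
  refine ⟨g1, g2, ?_, ?_, uX, uY⟩
  · intro t ht
    have := g2 u uR uX t (aP _ ht _ uP).symm
    grind
  · intro t ht
    have := g1 u uP uY t (aR _ uR _ ht)
    grind

theorem caseIIIa [Fintype V] (c : Cfg H X Y P1 P2 R1 R2) (q : {S : Set V // IsBiclique H S})
    (hconn : H.Connected) (hq : q.1 = X ∪ Y) (v w u : V)
    (vX : v ∈ X) (vP : v ∈ P1) (vR : v ∉ R1) (wY : w ∈ Y) (wR : w ∈ R2) (wP : w ∉ P2)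
    (uP : u ∈ P2) (uR : u ∈ R1) (hZ : ∀ z ∈ P1, z ∉ R2) : Concl H q := by
  have cE := c.E
  obtain ⟨g1, g2, g3, g4, uX, uY⟩ := c.caseIII_facts v w u vX vP vR wY wR wP uP uR
  have k1 : ∀ t ∈ P1, t ∈ X := fun t ht => by
    rcases g3 t ht with h | h
    · exact absurd h (hZ t ht)
    · exact h.1
  have k2 : ∀ t ∈ R2, t ∈ Y := fun t ht => by
    rcases g4 t ht with h | h
    · exact absurd ht (hZ t h)
    · exact h.1
  clear g3 g4 hZ
  have hC := closed_univ hconn {t | t ∈ X ∨ t ∈ Y ∨ t ∈ P2 ∨ t ∈ R1} v (Or.inl vX) (by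
    rintro a ha b hab
    simp only [Set.mem_ofPred_eq] at ha ⊢
    have := fun h => cE a b hab (Or.inl h)
    have := fun h => cE b a hab.symm (Or.inr h)
    have := fun h h' => g1 a h h' b hab
    have := fun h h' => g2 a h h' b hab
    have := k1 b
    have := k2 b
    clear g1 g2 k1 k2 cE hq
    grind)
  simp only [Set.mem_ofPred_eq] at hC
  refine c.K3' q hq ?_ ⟨u, Or.inr uP, Or.inl uR⟩
  intro a b hab
  have := hC a
  have := fun h h' => g1 a h h' b hab
  have := fun h h' => g2 a h h' b hab
  have := k1 b
  have := k2 b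
  clear g1 g2 k1 k2 cE hq
  grind

theorem caseIIIb [Fintype V] (c : Cfg H X Y P1 P2 R1 R2) (q : {S : Set V // IsBiclique H S})
    (hconn : H.Connected) (hq : q.1 = X ∪ Y) (v w u z x : V)
    (vX : v ∈ X) (vP : v ∈ P1) (vR : v ∉ R1) (wY : w ∈ Y) (wR : w ∈ R2) (wP : w ∉ P2)
    (uP : u ∈ P2) (uR : u ∈ R1) (zP : z ∈ P1) (zR : z ∈ R2) (xX : x ∈ X) (xR : x ∈ R1) :
    Concl H q := by
  have cE := c.E
  have cT := c.T
  obtain ⟨g1, g2, g3, g4, uX, uY⟩ := c.caseIII_facts v w u vX vP vR wY wR wP uP uR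
  have dP := Set.disjoint_left.1 c.P.2.2.1
  have dR := Set.disjoint_left.1 c.R.2.2.1
  have dq := Set.disjoint_left.1 c.q.2.2.1
  obtain ⟨-, -, -, iX, iY, aq⟩ := c.q
  obtain ⟨-, -, -, iP1, iP2, aP⟩ := c.P
  obtain ⟨-, -, -, iR1, iR2, aR⟩ := c.R
  have sy : ∀ a b, H.Adj a b → H.Adj b a := fun a b h => h.symm
  have p1y := c.p1y
  have p2x := c.p2x
  have r1y := c.r1y
  have r2x := c.r2x
  have hP'' : ∀ p ∈ P2, p ∈ Y ∨ p ∈ R1 := by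
    intro p hp
    by_contra hcon
    rw [not_or] at hcon
    have hxp : ¬ H.Adj x p := by
      intro h
      have := cE x p h (Or.inl xX)
      grind
    have := cT x z p (aR _ xR _ zR) (aP _ zP _ hp).symm hxp (Or.inl xX)
    grind
  have hZn : ∀ z ∈ P1, z ∈ R2 → ∀ s, H.Adj z s → s ∈ Y ∨ s ∈ P2 ∨ s ∈ R1 := by
    intro z zP zR s hzs
    by_cases hxs : H.Adj x s
    · have := cE x s hxs (Or.inl xX)
      grind
    · have := cT x z s (aR _ xR _ zR) hzs.symm hxs (Or.inl xX)
      grind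
  have hC := closed_univ hconn {t | t ∈ X ∨ t ∈ Y ∨ t ∈ R2 ∨ t ∈ R1} v (Or.inl vX) (by
    rintro a ha b hab
    simp only [Set.mem_ofPred_eq] at ha ⊢
    have := fun h => cE a b hab (Or.inl h)
    have := fun h => cE b a hab.symm (Or.inr h)
    grind)
  simp only [Set.mem_ofPred_eq] at hC
  refine c.K3 q hq (fun B hB => ?_) ⟨u, Or.inr uP, Or.inl uR⟩
  by_cases hm : (B ∩ (X ∪ Y)).Nonempty
  · exact c.all B hB hm
  · right; right
    refine hB.2 _ c.bR.1 fun t ht => ?_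
    have h1 : t ∉ X := fun h => hm ⟨t, ht, Or.inl h⟩
    have h2 : t ∉ Y := fun h => hm ⟨t, ht, Or.inr h⟩
    rcases hC t with h | h | h | h
    · exact absurd h h1
    · exact absurd h h2
    · exact Or.inr h
    · exact Or.inl h

end Cfg

/-- A set of `Option V` given by its trace on `V` and whether it has `none`. -/
def liftSet {V : Type} (S : Set V) (p : Prop) : Set (Option V) := {o | o.elim p (fun a => a ∈ S)}

theorem some_mem_liftSet {V : Type} (S : Set V) (p : Prop) (a : V) :
    some a ∈ liftSet S p ↔ a ∈ S := Iff.rfl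

theorem none_mem_liftSet {V : Type} (S : Set V) (p : Prop) : none ∈ liftSet S p ↔ p := Iff.rfl

/-- The modified graph of the last case. -/
def optGraph {V : Type} (H : SimpleGraph V) (Q XP YR Z P2 : Set V) : SimpleGraph (Option V) where
  Adj o o' := match o, o' with
    | some a, some b => (H.Adj a b ∧ a ∉ Q ∧ b ∉ Q) ∨
        (a ≠ b ∧ ((a ∈ P2 ∧ (b ∈ XP ∨ b ∈ YR)) ∨ (b ∈ P2 ∧ (a ∈ XP ∨ a ∈ YR))))
    | none, some b => b ∈ Z ∨ b ∈ YR
    | some a, none => a ∈ Z ∨ a ∈ YR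
    | none, none => False
  symm := ⟨by
    rintro (_ | a) (_ | b) h
    · exact h
    · exact h
    · exact h
    · rcases h with h | h
      · exact Or.inl ⟨h.1.symm, h.2.2, h.2.1⟩
      · exact Or.inr ⟨h.1.symm, h.2.symm⟩⟩
  loopless := ⟨by
    rintro (_ | a) h
    · exact h
    · rcases h with h | h
      · exact H.loopless.irrefl a h.1
      · exact h.1 rfl⟩

theorem og_ss {V : Type} {H : SimpleGraph V} {Q XP YR Z P2 : Set V} (a b : V) :
    (optGraph H Q XP YR Z P2).Adj (some a) (some b) ↔ (H.Adj a b ∧ a ∉ Q ∧ b ∉ Q) ∨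
        (a ≠ b ∧ ((a ∈ P2 ∧ (b ∈ XP ∨ b ∈ YR)) ∨ (b ∈ P2 ∧ (a ∈ XP ∨ a ∈ YR)))) := Iff.rfl

theorem og_ns {V : Type} {H : SimpleGraph V} {Q XP YR Z P2 : Set V} (b : V) :
    (optGraph H Q XP YR Z P2).Adj none (some b) ↔ b ∈ Z ∨ b ∈ YR := Iff.rfl

theorem og_sn {V : Type} {H : SimpleGraph V} {Q XP YR Z P2 : Set V} (b : V) :
    (optGraph H Q XP YR Z P2).Adj (some b) none ↔ b ∈ Z ∨ b ∈ YR := Iff.rfl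

theorem og_nn {V : Type} {H : SimpleGraph V} {Q XP YR Z P2 : Set V} :
    (optGraph H Q XP YR Z P2).Adj none none ↔ False := Iff.rfl

theorem cb_of_cbp {V : Type} {H : SimpleGraph V} {C1 C2 : Set V} (h : IsCBP H C1 C2) :
    IsCompleteBipartiteSet H (C1 ∪ C2) := ⟨C1, C2, h, rfl⟩

set_option maxHeartbeats 4000000 in
open Classical in
theorem opt_case {V : Type} [Fintype V] (H : SimpleGraph V) (q : {S : Set V // IsBiclique H S})
    (Q XP YR Z P2 R1 P R : Set V) (hq : q.1 = Q)
    (xQ : ∀ a ∈ XP, a ∈ Q) (yQ : ∀ a ∈ YR, a ∈ Q) (xy : ∀ a ∈ XP, a ∉ YR)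
    (pQ : ∀ a ∈ P2, a ∉ Q) (rQ : ∀ a ∈ R1, a ∉ Q) (zQ : ∀ a ∈ Z, a ∉ Q)
    (zp : ∀ a ∈ Z, a ∉ P2) (zr : ∀ a ∈ Z, a ∉ R1)
    (dn : ∀ d, d ∈ P2 ∨ d ∈ R1 → ∀ s, s ∉ Q → (H.Adj d s ↔ s ∈ Z))
    (zi : ∀ a ∈ Z, ∀ b ∈ Z, ¬ H.Adj a b)
    (mP : ∀ a, a ∈ P ↔ a ∈ XP ∨ a ∈ Z ∨ a ∈ P2)
    (mR : ∀ a, a ∈ R ↔ a ∈ YR ∨ a ∈ Z ∨ a ∈ R1)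
    (bP : IsBiclique H P) (bR : IsBiclique H R) (nPq : P ≠ Q) (nRq : R ≠ Q)
    (oth : ∀ B, IsBiclique H B → B ≠ Q → B ≠ P → B ≠ R → ∀ a ∈ B, a ∉ Q)
    (v w u z : V) (hv : v ∈ XP) (hw : w ∈ YR) (uP : u ∈ P2) (uR : u ∈ R1) (hz : z ∈ Z)
    (hsub : (∀ a ∈ P2, a ∈ R1) → ∀ a ∈ R1, a ∈ P2) : Concl H q := by
  have nPR : P ≠ R := by
    intro h
    have h1 := (mP v).2 (Or.inl hv)
    rw [h, mR] at h1
    grind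
  set G := optGraph H Q XP YR Z P2 with hG
  set FP : Set (Option V) := liftSet {a | a ∈ XP ∨ a ∈ YR ∨ a ∈ Z ∨ a ∈ P2} False with hFP
  set FR : Set (Option V) := liftSet {a | a ∈ YR ∨ a ∈ Z ∨ a ∈ P2} True with hFR
  have sFP : ∀ a, some a ∈ FP ↔ a ∈ XP ∨ a ∈ YR ∨ a ∈ Z ∨ a ∈ P2 := fun _ => Iff.rfl
  have nFP : none ∉ FP := fun h => h
  have sFR : ∀ a, some a ∈ FR ↔ a ∈ YR ∨ a ∈ Z ∨ a ∈ P2 := fun _ => Iff.rfl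
  have nFR : none ∈ FR := trivial
  have sy : ∀ a b, H.Adj a b → H.Adj b a := fun a b h => h.symm
  have hss := @og_ss V H Q XP YR Z P2
  have hns := @og_ns V H Q XP YR Z P2
  have hsn := @og_sn V H Q XP YR Z P2
  have hnn := @og_nn V H Q XP YR Z P2
  rw [← hG] at hss hns hsn hnn
  have dnP : ∀ d ∈ P2, ∀ s, s ∉ Q → (H.Adj d s ↔ s ∈ Z) := fun d h => dn d (Or.inl h)
  -- neighbourhoods in G
  have NX : ∀ a ∈ XP, ∀ o, G.Adj (some a) o → ∃ b ∈ P2, o = some b := by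
    rintro a ha (_ | b) h
    · rw [hsn] at h; grind
    · rw [hss] at h; exact ⟨b, by grind, rfl⟩
  have NY : ∀ a ∈ YR, ∀ o, G.Adj (some a) o → o = none ∨ ∃ b ∈ P2, o = some b := by
    rintro a ha (_ | b) h
    · exact Or.inl rfl
    · rw [hss] at h; exact Or.inr ⟨b, by grind, rfl⟩
  have NP : ∀ a ∈ P2, ∀ o, G.Adj (some a) o → ∃ b, (b ∈ XP ∨ b ∈ YR ∨ b ∈ Z) ∧ o = some b := by
    rintro a ha (_ | b) h
    · rw [hsn] at h; grind
    · rw [hss] at h; exact ⟨b, by grind, rfl⟩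
  have NN : ∀ o, G.Adj none o → ∃ b, (b ∈ YR ∨ b ∈ Z) ∧ o = some b := by
    rintro (_ | b) h
    · exact absurd h id
    · rw [hns] at h; exact ⟨b, by grind, rfl⟩
  have NQ : ∀ a ∈ Q, ∀ o, G.Adj (some a) o → a ∈ XP ∨ a ∈ YR := by
    rintro a ha (_ | b) h
    · rw [hsn] at h; grind
    · rw [hss] at h; grind
  have adjO : ∀ a b, a ∉ Q → b ∉ Q → (G.Adj (some a) (some b) ↔ H.Adj a b) := by
    intro a b ha hb
    rw [hss]; grind
  -- complete bipartite sets of G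
  have M1 : ∀ C1 C2, IsCBP G C1 C2 → ∀ a ∈ XP, some a ∈ C1 → C1 ∪ C2 ⊆ FP := by
    rintro C1 C2 ⟨-, ⟨d, hd⟩, -, -, -, h12⟩ a ha hac
    have h2 : ∀ o ∈ C2, ∃ b ∈ P2, o = some b := fun o ho => NX a ha o (h12 _ hac _ ho)
    rintro o (ho | ho)
    · obtain ⟨b, hb, rfl⟩ := h2 d hd
      obtain ⟨e, he, rfl⟩ := NP b hb o (h12 _ ho _ hd).symm
      rw [sFP]; grind
    · obtain ⟨b, hb, rfl⟩ := h2 o ho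
      rw [sFP]; grind
  have M1' : ∀ T, IsCompleteBipartiteSet G T → ∀ a ∈ XP, some a ∈ T → T ⊆ FP := by
    rintro T ⟨C1, C2, hC, rfl⟩ a ha (h | h)
    · exact M1 C1 C2 hC a ha h
    · rw [Set.union_comm]; exact M1 C2 C1 hC.symm' a ha h
  have M2 : ∀ C1 C2, IsCBP G C1 C2 → ∀ a ∈ YR, some a ∈ C1 → (∀ b ∈ XP, some b ∉ C1) →
      C1 ∪ C2 ⊆ FR := by
    rintro C1 C2 ⟨-, ⟨d, hd⟩, -, -, -, h12⟩ a ha hac hx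
    have h2 : ∀ o ∈ C2, o = none ∨ ∃ b ∈ P2, o = some b := fun o ho => NY a ha o (h12 _ hac _ ho)
    rintro o (ho | ho)
    · rcases h2 d hd with rfl | ⟨b, hb, rfl⟩
      · obtain ⟨e, he, rfl⟩ := NN o (h12 _ ho _ hd).symm
        rw [sFR]; grind
      · obtain ⟨e, he, rfl⟩ := NP b hb o (h12 _ ho _ hd).symm
        rw [sFR]; grind
    · rcases h2 o ho with rfl | ⟨b, hb, rfl⟩
      · exact nFR
      · rw [sFR]; grind
  have M2' : ∀ T, IsCompleteBipartiteSet G T → ∀ a ∈ YR, some a ∈ T → (∀ b ∈ XP, some b ∉ T) →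
      T ⊆ FR := by
    rintro T ⟨C1, C2, hC, rfl⟩ a ha (h | h) hx
    · exact M2 C1 C2 hC a ha h fun b hb h => hx b hb (Or.inl h)
    · rw [Set.union_comm]
      exact M2 C2 C1 hC.symm' a ha h fun b hb h => hx b hb (Or.inr h)
  have cFP : IsCompleteBipartiteSet G FP := by
    refine ⟨liftSet {a | a ∈ XP ∨ a ∈ YR ∨ a ∈ Z} False, liftSet P2 False,
      isCBP_mk ⟨some v, Or.inl hv⟩ ⟨some u, uP⟩ ?_ ?_ ?_, ?_⟩
    · rintro (_ | a) ha (_ | b) hb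
      · exact ha.elim
      · exact ha.elim
      · exact hb.elim
      · change a ∈ XP ∨ a ∈ YR ∨ a ∈ Z at ha
        change b ∈ XP ∨ b ∈ YR ∨ b ∈ Z at hb
        rw [hss]; grind
    · rintro (_ | a) ha (_ | b) hb
      · exact ha.elim
      · exact ha.elim
      · exact hb.elim
      · change a ∈ P2 at ha
        change b ∈ P2 at hb
        rw [hss]; grind
    · rintro (_ | a) ha (_ | b) hb
      · exact ha.elim
      · exact ha.elim
      · exact hb.elim
      · change a ∈ XP ∨ a ∈ YR ∨ a ∈ Z at ha
        change b ∈ P2 at hb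
        rw [hss]; grind
    · ext (_ | a)
      · exact or_self_iff
      · change (a ∈ XP ∨ a ∈ YR ∨ a ∈ Z) ∨ a ∈ P2 ↔ a ∈ XP ∨ a ∈ YR ∨ a ∈ Z ∨ a ∈ P2
        tauto
  have cFR : IsCompleteBipartiteSet G FR := by
    refine ⟨liftSet {a | a ∈ YR ∨ a ∈ Z} False, liftSet P2 True,
      isCBP_mk ⟨some w, Or.inl hw⟩ ⟨some u, uP⟩ ?_ ?_ ?_, ?_⟩
    · rintro (_ | a) ha (_ | b) hb
      · exact ha.elim
      · exact ha.elim
      · exact hb.elim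
      · change a ∈ YR ∨ a ∈ Z at ha
        change b ∈ YR ∨ b ∈ Z at hb
        rw [hss]; grind
    · rintro (_ | a) ha (_ | b) hb
      · exact id
      · change b ∈ P2 at hb
        rw [hns]; grind
      · change a ∈ P2 at ha
        rw [hsn]; grind
      · change a ∈ P2 at ha
        change b ∈ P2 at hb
        rw [hss]; grind
    · rintro (_ | a) ha (_ | b) hb
      · exact ha.elim
      · exact ha.elim
      · change a ∈ YR ∨ a ∈ Z at ha
        rw [hsn]; grind
      · change a ∈ YR ∨ a ∈ Z at ha
        change b ∈ P2 at hb
        rw [hss]; grind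
    · ext (_ | a)
      · exact or_iff_right id
      · change (a ∈ YR ∨ a ∈ Z) ∨ a ∈ P2 ↔ a ∈ YR ∨ a ∈ Z ∨ a ∈ P2
        tauto
  have bFP : IsBiclique G FP :=
    ⟨cFP, fun T hT h => le_antisymm h (M1' T hT v hv (h (Or.inl hv)))⟩
  have bFR : IsBiclique G FR := by
    refine ⟨cFR, fun T hT h => le_antisymm h (M2' T hT w hw (h (Or.inl hw)) ?_)⟩
    intro b hb hbT
    exact nFP (M1' T hT b hb hbT (h nFR))
  -- other bicliques of H meeting D
  have LD0 : ∀ C1 C2, IsCBP H C1 C2 → IsBiclique H (C1 ∪ C2) → (∀ a ∈ C1 ∪ C2, a ∉ Q) →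
      ∀ a ∈ C1, a ∈ Z → (∀ a ∈ C1, a ∈ Z) → ∀ d, d ∈ P2 ∨ d ∈ R1 → d ∈ C2 := by
    intro C1 C2 hC hB hO a haC haZ hZ d hd
    refine biclique_ext (A := C2) (B := C1) (by rwa [Set.union_comm]) hC.symm' d ?_ ?_
    · intro s hs h
      have := (dn d hd s (hO s (Or.inr hs))).1 h
      exact zi _ haZ _ this (hC.2.2.2.2.2 a haC s hs)
    · intro s hs
      exact (dn d hd s (hO s (Or.inl hs))).2 (hZ s hs)
  have LD1 : ∀ C1 C2, IsCBP H C1 C2 → (∀ a ∈ C1 ∪ C2, a ∉ Q) →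
      ∀ d, d ∈ P2 ∨ d ∈ R1 → d ∈ C2 → ∀ a ∈ C1, a ∈ Z := by
    intro C1 C2 hC hO d hd hdC a ha
    exact (dn d hd a (hO a (Or.inl ha))).1 (hC.2.2.2.2.2 a ha d hdC).symm
  have LD : ∀ T, IsBiclique H T → (∀ a ∈ T, a ∉ Q) → ∀ d, d ∈ P2 ∨ d ∈ R1 → d ∈ T →
      (∃ a ∈ T, a ∈ Z) ∧ ∀ d, d ∈ P2 ∨ d ∈ R1 → d ∈ T := by
    intro T hT hO d hd hdT
    obtain ⟨C1, C2, hC, rfl⟩ := hT.1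
    rcases hdT with hdT | hdT
    · have h1 := LD1 C2 C1 hC.symm' (by rwa [Set.union_comm]) d hd hdT
      obtain ⟨x, hx⟩ := hC.2.1
      refine ⟨⟨x, Or.inr hx, h1 x hx⟩, fun d' hd' => Or.inl ?_⟩
      exact LD0 C2 C1 hC.symm' (by rwa [Set.union_comm]) (by rwa [Set.union_comm]) x hx (h1 x hx)
        h1 d' hd'
    · have h1 := LD1 C1 C2 hC hO d hd hdT
      obtain ⟨x, hx⟩ := hC.1
      refine ⟨⟨x, Or.inl hx, h1 x hx⟩, fun d' hd' => Or.inr ?_⟩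
      exact LD0 C1 C2 hC hT hO x hx (h1 x hx) h1 d' hd'
  have notP : ∀ T, IsBiclique H T → T ≠ P → ¬ ∀ a ∈ T, a ∈ Z ∨ a ∈ P2 := by
    intro T hT hne h
    exact hne (hT.2 P bP.1 fun a ha => (mP a).2 (Or.inr (h a ha)))
  -- complete bipartite sets of G outside of q
  have CO : ∀ C1 C2, IsCBP G C1 C2 → (∀ a ∈ Q, some a ∉ C1 ∪ C2) →
      (∃ a, some a ∈ C1) → (∃ a, some a ∈ C2) → IsCBP H (some ⁻¹' C1) (some ⁻¹' C2) := by
    rintro C1 C2 hC hO h1 h2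
    have o1 : ∀ a, some a ∈ C1 → a ∉ Q := fun a h h' => hO a h' (Or.inl h)
    have o2 : ∀ a, some a ∈ C2 → a ∉ Q := fun a h h' => hO a h' (Or.inr h)
    refine isCBP_mk h1 h2 ?_ ?_ ?_
    · intro a ha b hb h
      exact hC.2.2.2.1 _ ha _ hb ((adjO a b (o1 a ha) (o1 b hb)).2 h)
    · intro a ha b hb h
      exact hC.2.2.2.2.1 _ ha _ hb ((adjO a b (o2 a ha) (o2 b hb)).2 h)
    · intro a ha b hb
      exact (adjO a b (o1 a ha) (o2 b hb)).1 (hC.2.2.2.2.2 _ ha _ hb)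
  have TQ : ∀ T, IsCompleteBipartiteSet G T → (∀ a ∈ XP, some a ∉ T) → (∀ a ∈ YR, some a ∉ T) →
      ∀ a ∈ Q, some a ∉ T := by
    rintro T ⟨C1, C2, ⟨⟨x, hx⟩, ⟨y, hy⟩, -, -, -, h12⟩, rfl⟩ h1 h2 a ha haT
    have : a ∈ XP ∨ a ∈ YR := by
      rcases haT with h | h
      · exact NQ a ha y (h12 _ h _ hy)
      · exact NQ a ha x (h12 _ hx _ h).symm
    rcases this with h | h
    · exact h1 a h haT
    · exact h2 a h haT
  -- lifts of other bicliques
  have cT : ∀ T, IsBiclique H T → (∀ a ∈ T, a ∉ Q) →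
      IsCompleteBipartiteSet G (liftSet T (u ∈ T)) := by
    have aux : ∀ C1 C2, IsCBP H C1 C2 → (∀ a ∈ C1 ∪ C2, a ∉ Q) → u ∉ C1 →
        IsCompleteBipartiteSet G (liftSet (C1 ∪ C2) (u ∈ C1 ∪ C2)) := by
      intro C1 C2 hC hO hu
      have o1 : ∀ a ∈ C1, a ∉ Q := fun a h => hO a (Or.inl h)
      have o2 : ∀ a ∈ C2, a ∉ Q := fun a h => hO a (Or.inr h)
      have l1 := LD1 C1 C2 hC hO u (Or.inl uP)
      have l2 : u ∈ C2 → ∀ a ∈ C2, a ∉ Z := by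
        intro h a ha haZ
        obtain ⟨x, hx⟩ := hC.1
        exact zi _ (l1 h x hx) _ haZ (hC.2.2.2.2.2 x hx a ha)
      obtain ⟨⟨x, hx⟩, ⟨y, hy⟩, -, i1, i2, h12⟩ := hC
      refine ⟨liftSet C1 False, liftSet C2 (u ∈ C2), isCBP_mk ⟨some x, hx⟩ ⟨some y, hy⟩ ?_ ?_ ?_, ?_⟩
      · rintro (_ | a) ha (_ | b) hb
        · exact ha.elim
        · exact ha.elim
        · exact hb.elim
        · rw [adjO a b (o1 a ha) (o1 b hb)]
          exact i1 a ha b hb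
      · rintro (_ | a) ha (_ | b) hb
        · exact id
        · rw [hns]
          have := l2 ha b hb
          have := o2 b hb
          grind
        · rw [hsn]
          have := l2 hb a ha
          have := o2 a ha
          grind
        · rw [adjO a b (o2 a ha) (o2 b hb)]
          exact i2 a ha b hb
      · rintro (_ | a) ha (_ | b) hb
        · exact ha.elim
        · exact ha.elim
        · rw [hsn]
          exact Or.inl (l1 hb a ha)
        · rw [adjO a b (o1 a ha) (o2 b hb)]
          exact h12 a ha b hb
      · ext (_ | a)
        · change False ∨ u ∈ C2 ↔ u ∈ C1 ∨ u ∈ C2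
          tauto
        · exact Iff.rfl
    intro T hT hO
    obtain ⟨C1, C2, hC, rfl⟩ := hT.1
    by_cases hu : u ∈ C1
    · rw [Set.union_comm]
      refine aux C2 C1 hC.symm' (by rwa [Set.union_comm]) fun h => ?_
      exact Set.disjoint_left.1 hC.2.2.1 hu h
    · exact aux C1 C2 hC hO hu
  -- none in T forces the opposite side into Z
  have NZ : ∀ C1 C2, IsCBP G C1 C2 → (∀ a ∈ Q, some a ∉ C1 ∪ C2) → none ∈ C2 →
      ∀ o ∈ C1, ∃ a ∈ Z, o = some a := by
    intro C1 C2 hC hO hn o ho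
    obtain ⟨b, hb, rfl⟩ := NN o (hC.2.2.2.2.2 _ ho _ hn).symm
    refine ⟨b, ?_, rfl⟩
    rcases hb with hb | hb
    · exact absurd (Or.inl ho) (hO b (yQ b hb))
    · exact hb
  have bT : ∀ T, IsBiclique H T → (∀ a ∈ T, a ∉ Q) → T ≠ P →
      IsBiclique G (liftSet T (u ∈ T)) := by
    intro T hT hO hTP
    refine ⟨cT T hT hO, fun T' hT' hsubT => ?_⟩
    have hTT : ∀ a ∈ T, some a ∈ T' := fun a ha => hsubT ha
    have a1 : ∀ a ∈ XP, some a ∉ T' := by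
      intro a ha haT
      have h := M1' T' hT' a ha haT
      refine notP T hT hTP fun b hb => ?_
      have h1 := (sFP b).1 (h (hTT b hb))
      have h2 := hO b hb
      grind
    have a2 : ∀ a ∈ YR, some a ∉ T' := by
      intro a ha haT
      have h := M2' T' hT' a ha haT a1
      refine notP T hT hTP fun b hb => ?_
      have h1 := (sFR b).1 (h (hTT b hb))
      have h2 := hO b hb
      grind
    have a3 := TQ T' hT' a1 a2
    obtain ⟨C1, C2, hC, rfl⟩ := hT'
    obtain ⟨D1, D2, hD, rfl⟩ := hT.1
    obtain ⟨x, hx⟩ := hD.1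
    obtain ⟨y, hy⟩ := hD.2.1
    have hxy : G.Adj (some x) (some y) :=
      (adjO x y (hO x (Or.inl hx)) (hO y (Or.inr hy))).2 (hD.2.2.2.2.2 x hx y hy)
    have hne : (∃ a, some a ∈ C1) ∧ (∃ a, some a ∈ C2) := by
      rcases hTT x (Or.inl hx) with h1 | h1 <;> rcases hTT y (Or.inr hy) with h2 | h2
      · exact absurd hxy (hC.2.2.2.1 _ h1 _ h2)
      · exact ⟨⟨x, h1⟩, ⟨y, h2⟩⟩
      · exact ⟨⟨y, h2⟩, ⟨x, h1⟩⟩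
      · exact absurd hxy (hC.2.2.2.2.1 _ h1 _ h2)
    have hH := CO C1 C2 hC a3 hne.1 hne.2
    have heq := hT.2 _ (cb_of_cbp hH) (fun a ha => hTT a ha)
    rw [heq] at hT hO
    ext (_ | a)
    · refine ⟨fun h => hsubT h, fun h => ?_⟩
      change u ∈ D1 ∪ D2
      rw [heq]
      rcases h with h | h
      · have hz := NZ C2 C1 hC.symm' (by rwa [Set.union_comm]) h
        have hz' : ∀ a ∈ some ⁻¹' C2, a ∈ Z := by
          intro a ha
          obtain ⟨b, hb, e⟩ := hz _ ha
          cases e; exact hb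
        obtain ⟨y, hy⟩ := hne.2
        exact Or.inl (LD0 (some ⁻¹' C2) (some ⁻¹' C1) hH.symm' (by rwa [Set.union_comm])
          (by rwa [Set.union_comm]) y hy (hz' y hy) hz' u (Or.inl uP))
      · have hz := NZ C1 C2 hC a3 h
        have hz' : ∀ a ∈ some ⁻¹' C1, a ∈ Z := by
          intro a ha
          obtain ⟨b, hb, e⟩ := hz _ ha
          cases e; exact hb
        obtain ⟨y, hy⟩ := hne.1
        exact Or.inr (LD0 (some ⁻¹' C1) (some ⁻¹' C2) hH hT
          hO y hy (hz' y hy) hz' u (Or.inl uP))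
    · change a ∈ D1 ∪ D2 ↔ _
      rw [heq]; exact Iff.rfl
  -- bicliques of G
  have surj : ∀ T, IsBiclique G T → T = FP ∨ T = FR ∨
      ∃ B, IsBiclique H B ∧ B ≠ Q ∧ B ≠ P ∧ B ≠ R ∧ liftSet B (u ∈ B) = T := by
    intro T hT
    by_contra hcon
    rw [not_or, not_or] at hcon
    obtain ⟨n1, n2, n3⟩ := hcon
    have a1 : ∀ a ∈ XP, some a ∉ T := fun a ha h => n1 (hT.2 _ cFP (M1' T hT.1 a ha h))
    have a2 : ∀ a ∈ YR, some a ∉ T := fun a ha h => n2 (hT.2 _ cFR (M2' T hT.1 a ha h a1))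
    have a3 := TQ T hT.1 a1 a2
    have main : ∀ C1 C2, IsCBP G C1 C2 → C1 ∪ C2 = T → none ∉ C1 →
        (∀ d, d ∈ P2 ∨ d ∈ R1 → some d ∉ C1) → False := by
      rintro C1 C2 hC rfl hn hd
      obtain ⟨x, hx⟩ := hC.1
      obtain ⟨y, hy⟩ := hC.2.1
      -- if C2 meets D or none then it contains all of these
      have hDN : (none ∈ C2 ∨ ∃ d, (d ∈ P2 ∨ d ∈ R1) ∧ some d ∈ C2) →
          none ∈ C2 ∧ ∀ d, (d ∈ P2 ∨ d ∈ R1) → some d ∈ C2 := by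
        intro h
        have hZ : ∀ o ∈ C1, ∃ a ∈ Z, o = some a := by
          rcases h with h | ⟨d, hd, h⟩
          · exact NZ C1 C2 hC a3 h
          · rintro (_ | a) ha
            · exact absurd ha hn
            · refine ⟨a, ?_, rfl⟩
              have haQ : a ∉ Q := fun h' => a3 a h' (Or.inl ha)
              have hdQ : d ∉ Q := fun h' => a3 d h' (Or.inr h)
              exact (dn d hd a haQ).1 ((adjO a d haQ hdQ).1 (hC.2.2.2.2.2 _ ha _ h)).symm
        have hZ2 : ∀ a, some a ∈ C2 → a ∉ Z ∧ a ∉ Q := by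
          intro a ha
          have haQ : a ∉ Q := fun h' => a3 a h' (Or.inr ha)
          refine ⟨fun haZ => ?_, haQ⟩
          obtain ⟨b, hb, rfl⟩ := hZ x hx
          exact zi b hb a haZ ((adjO b a (zQ b hb) haQ).1 (hC.2.2.2.2.2 _ hx _ ha))
        have hT' : IsBiclique G (C2 ∪ C1) := by rwa [Set.union_comm]
        constructor
        · refine biclique_ext hT' hC.symm' none ?_ ?_
          · rintro (_ | a) ha
            · exact id
            · rw [hns]
              have := hZ2 a ha
              grind
          · intro o ho
            obtain ⟨b, hb, rfl⟩ := hZ o ho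
            rw [hns]; exact Or.inl hb
        · intro d hd
          have hdQ : d ∉ Q := by grind
          refine biclique_ext hT' hC.symm' (some d) ?_ ?_
          · rintro (_ | a) ha
            · rw [hsn]; grind
            · rw [adjO d a hdQ (hZ2 a ha).2, dn d hd a (hZ2 a ha).2]
              exact (hZ2 a ha).1
          · intro o ho
            obtain ⟨b, hb, rfl⟩ := hZ o ho
            rw [adjO d b hdQ (zQ b hb), dn d hd b (zQ b hb)]
            exact hb
      have e1 : ∃ a, some a ∈ C1 := by
        rcases x with _ | a
        · exact absurd hx hn
        · exact ⟨a, hx⟩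
      have e2 : ∃ a, some a ∈ C2 := by
        rcases y with _ | a
        · exact ⟨u, (hDN (Or.inl hy)).2 u (Or.inl uP)⟩
        · exact ⟨a, hy⟩
      have hH := CO C1 C2 hC a3 e1 e2
      obtain ⟨B, hB, hTB⟩ := exists_biclique H (cb_of_cbp hH)
      obtain ⟨s, hs⟩ := e1
      obtain ⟨t, ht⟩ := e2
      have hsQ : s ∉ Q := fun h' => a3 s h' (Or.inl hs)
      have htQ : t ∉ Q := fun h' => a3 t h' (Or.inr ht)
      have hst : H.Adj s t := hH.2.2.2.2.2 s hs t ht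
      have hTB' : ∀ a, some a ∈ C1 ∪ C2 → a ∈ B := fun a ha => hTB ha
      have hsB := hTB' s (Or.inl hs)
      have htB := hTB' t (Or.inr ht)
      -- T is not inside P or R
      have inZ : (∀ a, some a ∈ C1 ∪ C2 → a ∈ Z ∨ a ∈ P2) → False := by
        intro h
        refine n2 (hT.2 _ cFR ?_)
        rintro (_ | a) ha
        · exact nFR
        · rw [sFR]; exact Or.inr (h a ha)
      by_cases hBq : B = Q
      · exact hsQ (hBq ▸ hsB)
      by_cases hBP : B = P
      · refine inZ fun a ha => ?_
        have h1 := hTB' a ha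
        rw [hBP, mP] at h1
        have : a ∉ Q := fun h' => a3 a h' ha
        grind
      by_cases hBR : B = R
      · have hin : ∀ a, some a ∈ C1 ∪ C2 → a ∈ Z ∨ a ∈ R1 := by
          intro a ha
          have h1 := hTB' a ha
          rw [hBR, mR] at h1
          have : a ∉ Q := fun h' => a3 a h' ha
          grind
        have h1 : s ∈ Z := by
          have := hin s (Or.inl hs)
          have := fun h => hd s (Or.inr h) hs
          grind
        have h2 : t ∈ R1 := by
          rcases hin t (Or.inr ht) with h | h
          · exact absurd hst (zi _ h1 _ h)
          · exact h
        have h3 := (hDN (Or.inr ⟨t, Or.inr h2, ht⟩)).2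
        have h4 : ∀ a ∈ P2, a ∈ R1 := by
          intro a ha
          have := hin a (Or.inr (h3 a (Or.inl ha)))
          grind
        have h5 := hsub h4
        refine inZ fun a ha => ?_
        rcases hin a ha with h | h
        · exact Or.inl h
        · exact Or.inr (h5 a h)
      have hBO := oth B hB hBq hBP hBR
      refine n3 ⟨B, hB, hBq, hBP, hBR, (hT.2 _ (cT B hB hBO) ?_).symm⟩
      rintro (_ | a) ha
      · change u ∈ B
        rcases ha with ha | ha
        · exact absurd ha hn
        · exact hTB' u (Or.inr ((hDN (Or.inl ha)).2 u (Or.inl uP)))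
      · exact hTB' a ha
    obtain ⟨C1, C2, hC, hCT⟩ := hT.1
    -- elements of D or none cannot lie in both sides
    have both : ∀ o1 ∈ C1, ∀ o2 ∈ C2, (o1 = none ∨ ∃ d, (d ∈ P2 ∨ d ∈ R1) ∧ o1 = some d) →
        (o2 = none ∨ ∃ d, (d ∈ P2 ∨ d ∈ R1) ∧ o2 = some d) → False := by
      intro o1 h1 o2 h2 k1 k2
      have hadj := hC.2.2.2.2.2 o1 h1 o2 h2
      rcases k1 with rfl | ⟨d, hd, rfl⟩ <;> rcases k2 with rfl | ⟨e, he, rfl⟩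
      · exact hadj
      · rw [hns] at hadj; grind
      · rw [hsn] at hadj; grind
      · have hdQ : d ∉ Q := by grind
        have heQ : e ∉ Q := by grind
        rw [adjO d e hdQ heQ, dn d hd e heQ] at hadj
        grind
    by_cases hc : ∃ o1 ∈ C1, (o1 = none ∨ ∃ d, (d ∈ P2 ∨ d ∈ R1) ∧ o1 = some d)
    · obtain ⟨o1, h1, k1⟩ := hc
      refine main C2 C1 hC.symm' (by rw [Set.union_comm]; exact hCT) ?_ ?_
      · exact fun h => both o1 h1 _ h k1 (Or.inl rfl)
      · exact fun d hd h => both o1 h1 _ h k1 (Or.inr ⟨d, hd, rfl⟩)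
    · refine main C1 C2 hC hCT ?_ ?_
      · exact fun h => hc ⟨_, h, Or.inl rfl⟩
      · exact fun d hd h => hc ⟨_, h, Or.inr ⟨d, hd, rfl⟩⟩
  -- the correspondence
  set φ : Set V → Set (Option V) :=
    fun B => if B = P then FP else if B = R then FR else liftSet B (u ∈ B) with hφ
  have φP : φ P = FP := if_pos rfl
  have φR : φ R = FR := by simp [hφ, nPR.symm]
  have φT : ∀ B, B ≠ P → B ≠ R → φ B = liftSet B (u ∈ B) := by
    intro B h1 h2; simp [hφ, h1, h2]
  have sep : ∀ B, IsBiclique H B → B ≠ Q →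
      B = P ∨ B = R ∨ (B ≠ P ∧ B ≠ R ∧ ∀ a ∈ B, a ∉ Q) := by
    intro B hB hBq
    by_cases h1 : B = P
    · exact Or.inl h1
    by_cases h2 : B = R
    · exact Or.inr (Or.inl h2)
    exact Or.inr (Or.inr ⟨h1, h2, oth B hB hBq h1 h2⟩)
  have neFPR : FP ≠ FR := fun h => nFP (h ▸ nFR)
  have neFP : ∀ B, (∀ a ∈ B, a ∉ Q) → liftSet B (u ∈ B) ≠ FP := by
    intro B hO h
    have : some v ∈ liftSet B (u ∈ B) := by rw [h]; exact Or.inl hv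
    exact hO v this (xQ v hv)
  have neFR : ∀ B, (∀ a ∈ B, a ∉ Q) → liftSet B (u ∈ B) ≠ FR := by
    intro B hO h
    have : some w ∈ liftSet B (u ∈ B) := by rw [h]; exact Or.inl hw
    exact hO w this (yQ w hw)
  have iPR : (FP ∩ FR).Nonempty ↔ (P ∩ R).Nonempty :=
    iff_of_true ⟨some z, (sFP z).2 (by tauto), (sFR z).2 (by tauto)⟩
      ⟨z, (mP z).2 (by tauto), (mR z).2 (by tauto)⟩
  have iPT : ∀ B, (∀ a ∈ B, a ∉ Q) →
      ((FP ∩ liftSet B (u ∈ B)).Nonempty ↔ (P ∩ B).Nonempty) := by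
    intro B hO
    constructor
    · rintro ⟨_ | a, h1, h2⟩
      · exact absurd h1 nFP
      · rw [sFP] at h1
        have := hO a h2
        exact ⟨a, (mP a).2 (by grind), h2⟩
    · rintro ⟨a, h1, h2⟩
      rw [mP] at h1
      exact ⟨some a, (sFP a).2 (by tauto), h2⟩
  have iRT : ∀ B, IsBiclique H B → (∀ a ∈ B, a ∉ Q) →
      ((FR ∩ liftSet B (u ∈ B)).Nonempty ↔ (R ∩ B).Nonempty) := by
    intro B hB hO
    constructor
    · rintro ⟨_ | a, h1, h2⟩
      · exact ⟨u, (mR u).2 (by tauto), h2⟩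
      · rw [sFR] at h1
        have h3 := hO a h2
        rcases h1 with h1 | h1 | h1
        · exact absurd (yQ a h1) h3
        · exact ⟨a, (mR a).2 (by tauto), h2⟩
        · obtain ⟨⟨b, hb, hbZ⟩, -⟩ := LD B hB hO a (Or.inl h1) h2
          exact ⟨b, (mR b).2 (by tauto), hb⟩
    · rintro ⟨a, h1, h2⟩
      rw [mR] at h1
      have h3 := hO a h2
      rcases h1 with h1 | h1 | h1
      · exact absurd (yQ a h1) h3
      · exact ⟨some a, (sFR a).2 (by tauto), h2⟩
      · obtain ⟨⟨b, hb, hbZ⟩, -⟩ := LD B hB hO a (Or.inr h1) h2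
        exact ⟨some b, (sFR b).2 (by tauto), hb⟩
  refine concl_mk H q G φ ?_ ?_ ?_ ?_
  · intro B hB hBq
    rw [hq] at hBq
    rcases sep B hB hBq with rfl | rfl | ⟨h1, h2, h3⟩
    · rw [φP]; exact bFP
    · rw [φR]; exact bFR
    · rw [φT B h1 h2]; exact bT B hB h3 h1
  · intro B B' hB hBq hB' hBq' h
    rw [hq] at hBq hBq'
    rcases sep B hB hBq with e | e | ⟨h1, h2, h3⟩ <;>
      rcases sep B' hB' hBq' with e' | e' | ⟨h1', h2', h3'⟩
    · rw [e, e']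
    · rw [e, e', φP, φR] at h; exact absurd h neFPR
    · rw [e, φP, φT B' h1' h2'] at h; exact absurd h.symm (neFP B' h3')
    · rw [e, e', φP, φR] at h; exact absurd h.symm neFPR
    · rw [e, e']
    · rw [e, φR, φT B' h1' h2'] at h; exact absurd h.symm (neFR B' h3')
    · rw [e', φP, φT B h1 h2] at h; exact absurd h (neFP B h3)
    · rw [e', φR, φT B h1 h2] at h; exact absurd h (neFR B h3)
    · rw [φT B h1 h2, φT B' h1' h2'] at h
      ext a
      have : some a ∈ liftSet B (u ∈ B) ↔ some a ∈ liftSet B' (u ∈ B') := by rw [h]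
      exact this
  · intro T hT
    rw [hq]
    rcases surj T hT with rfl | rfl | ⟨B, h1, h2, h3, h4, rfl⟩
    · exact ⟨P, bP, nPq, φP⟩
    · exact ⟨R, bR, nRq, φR⟩
    · exact ⟨B, h1, h2, φT B h3 h4⟩
  · intro B B' hB hBq hB' hBq' hne
    rw [hq] at hBq hBq'
    rcases sep B hB hBq with e | e | ⟨h1, h2, h3⟩ <;>
      rcases sep B' hB' hBq' with e' | e' | ⟨h1', h2', h3'⟩
    · exact absurd (e.trans e'.symm) hne
    · rw [e, e', φP, φR]; exact iPR
    · rw [e, φP, φT B' h1' h2']; exact iPT B' h3'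
    · rw [e, e', φP, φR, Set.inter_comm, Set.inter_comm R]; exact iPR
    · exact absurd (e.trans e'.symm) hne
    · rw [e, φR, φT B' h1' h2']; exact iRT B' hB' h3'
    · rw [e', φP, φT B h1 h2, Set.inter_comm, Set.inter_comm B]; exact iPT B h3
    · rw [e', φR, φT B h1 h2, Set.inter_comm, Set.inter_comm B]; exact iRT B hB h3
    · rw [φT B h1 h2, φT B' h1' h2']
      constructor
      · rintro ⟨_ | a, k1, k2⟩
        · exact ⟨u, k1, k2⟩
        · exact ⟨a, k1, k2⟩
      · rintro ⟨a, k1, k2⟩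
        exact ⟨some a, k1, k2⟩

namespace Cfg
variable {V : Type} {H : SimpleGraph V} {X Y P1 P2 R1 R2 : Set V}

theorem caseIIIc [Fintype V] (c : Cfg H X Y P1 P2 R1 R2) (q : {S : Set V // IsBiclique H S})
    (hq : q.1 = X ∪ Y) (v w u z : V)
    (vX : v ∈ X) (vP : v ∈ P1) (vR : v ∉ R1) (wY : w ∈ Y) (wR : w ∈ R2) (wP : w ∉ P2)
    (uP : u ∈ P2) (uR : u ∈ R1) (zP : z ∈ P1) (zR : z ∈ R2) (hX : ∀ x ∈ X, x ∉ R1)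
    (hY : ∀ y ∈ Y, y ∉ P2)
    (hsub : (∀ a ∈ P2, a ∈ R1) → ∀ a ∈ R1, a ∈ P2) : Concl H q := by
  obtain ⟨g1, g2, g3, g4, uX, uY⟩ := c.caseIII_facts v w u vX vP vR wY wR wP uP uR
  have dP := Set.disjoint_left.1 c.P.2.2.1
  have dR := Set.disjoint_left.1 c.R.2.2.1
  have dq := Set.disjoint_left.1 c.q.2.2.1
  obtain ⟨-, -, -, iP1, iP2, aP⟩ := c.P
  obtain ⟨-, -, -, iR1, iR2, aR⟩ := c.R
  have sy : ∀ a b, H.Adj a b → H.Adj b a := fun a b h => h.symm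
  have p1y := c.p1y
  have p2x := c.p2x
  have r1y := c.r1y
  have r2x := c.r2x
  refine opt_case H q (X ∪ Y) (X ∩ P1) (Y ∩ R2) (P1 ∩ R2) P2 R1 (P1 ∪ P2) (R1 ∪ R2) hq
    (fun a h => Or.inl h.1) (fun a h => Or.inr h.1) (fun a h h' => dq h.1 h'.1)
    ?_ ?_ ?_ (fun a h => dP h.1) (fun a h h' => dR h' h.2) ?_
    (fun a h b h' => iP1 a h.1 b h'.1) ?_ ?_ c.bP c.bR c.nPq c.nRq ?_ v w u z ⟨vX, vP⟩ ⟨wY, wR⟩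
    uP uR ⟨zP, zR⟩ hsub
  · rintro a h (h' | h')
    · exact p2x a h h'
    · exact hY a h' h
  · rintro a h (h' | h')
    · exact hX a h' h
    · exact r1y a h h'
  · rintro a ⟨h, h2⟩ (h' | h')
    · exact r2x a h2 h'
    · exact p1y a h h'
  · intro d hd s hs
    have hsX : s ∉ X := fun h => hs (Or.inl h)
    have hsY : s ∉ Y := fun h => hs (Or.inr h)
    rcases hd with hd | hd
    · refine ⟨fun h => ?_, fun h => (aP _ h.1 _ hd).symm⟩
      rcases g1 d hd (fun h => hY d h hd) s h with h | h
      · rcases g3 s h with h' | h'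
        · exact ⟨h, h'⟩
        · exact absurd h'.1 hsX
      · exact absurd h.1 hsY
    · refine ⟨fun h => ?_, fun h => aR _ hd _ h.2⟩
      rcases g2 d hd (fun h => hX d h hd) s h with h | h
      · rcases g4 s h with h' | h'
        · exact ⟨h', h⟩
        · exact absurd h'.1 hsY
      · exact absurd h.1 hsX
  · intro a
    have := g3 a
    simp only [Set.mem_union, Set.mem_inter_iff]
    tauto
  · intro a
    have := g4 a
    simp only [Set.mem_union, Set.mem_inter_iff]
    tauto
  · intro B hB h1 h2 h3 a ha ha'
    rcases c.all B hB ⟨a, ha, ha'⟩ with h | h | h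
    · exact h1 h
    · exact h2 h
    · exact h3 h

theorem caseIII [Fintype V] (c : Cfg H X Y P1 P2 R1 R2) (q : {S : Set V // IsBiclique H S})
    (hconn : H.Connected) (hq : q.1 = X ∪ Y) (v w u : V)
    (vX : v ∈ X) (vP : v ∈ P1) (vR : v ∉ R1) (wY : w ∈ Y) (wR : w ∈ R2) (wP : w ∉ P2)
    (uP : u ∈ P2) (uR : u ∈ R1) : Concl H q := by
  have hq' : q.1 = Y ∪ X := by rw [Set.union_comm]; exact hq
  by_cases hZ : ∀ z ∈ P1, z ∉ R2
  · exact c.caseIIIa q hconn hq v w u vX vP vR wY wR wP uP uR hZ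
  push Not at hZ
  obtain ⟨z, zP, zR⟩ := hZ
  by_cases hX : ∃ x ∈ X, x ∈ R1
  · obtain ⟨x, xX, xR⟩ := hX
    exact c.caseIIIb q hconn hq v w u z x vX vP vR wY wR wP uP uR zP zR xX xR
  by_cases hY : ∃ x ∈ Y, x ∈ P2
  · obtain ⟨x, xX, xR⟩ := hY
    exact c.side.swap.caseIIIb q hconn hq' w v u z x wY wR wP vX vP vR uR uP zR zP xX xR
  push Not at hX hY
  by_cases hs : (∀ a ∈ P2, a ∈ R1) → ∀ a ∈ R1, a ∈ P2
  · exact c.caseIIIc q hq v w u z vX vP vR wY wR wP uP uR zP zR hX hY hs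
  · exact c.side.swap.caseIIIc q hq' w v u z wY wR wP vX vP vR uR uP zR zP hY hX
      (fun h => by tauto)

theorem main [Fintype V] (c : Cfg H X Y P1 P2 R1 R2) (q : {S : Set V // IsBiclique H S})
    (hconn : H.Connected) (hq : q.1 = X ∪ Y) : Concl H q := by
  have hq' : q.1 = Y ∪ X := by rw [Set.union_comm]; exact hq
  by_contra hcon
  refine hcon (c.caseI q hq ?_ ?_ ?_ ?_)
  · intro v h1 h2 h3 w h4 h5 h6 u h7 h8
    exact hcon (c.caseIII q hconn hq v w u h1 h2 h3 h4 h5 h6 h7 h8)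
  · intro v h1 h2 h3 w h4 h5 h6 u h7 h8
    exact hcon (c.swap.caseIII q hconn hq v w u h1 h2 h3 h4 h5 h6 h7 h8)
  · intro v h1 h2 h3 w h4 h5 h6 u h7 h8 h9
    exact hcon (c.caseII q hconn hq v w u h1 h2 h3 h4 h5 h6 h7 h8 h9)
  · intro v h1 h2 h3 w h4 h5 h6 u h7 h8 h9
    exact hcon (c.side.caseII q hconn hq' v w u h1 h2 h3 h4 h5 h6 h7 h8 h9)

end Cfg

/-- Sides of a biclique can be oriented compatibly with the sides of `q`. -/
theorem orient {V : Type} {H : SimpleGraph V} {X Y P : Set V} (hq : IsCBP H X Y)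
    (hP : IsCompleteBipartiteSet H P) :
    ∃ A B, IsCBP H A B ∧ A ∪ B = P ∧ (∀ a ∈ A, a ∉ Y) ∧ (∀ a ∈ B, a ∉ X) := by
  obtain ⟨A, B, hAB, rfl⟩ := hP
  by_cases h : (∀ a ∈ A, a ∉ Y) ∧ (∀ a ∈ B, a ∉ X)
  · exact ⟨A, B, hAB, rfl, h⟩
  · refine ⟨B, A, hAB.symm', Set.union_comm _ _, ?_⟩
    obtain ⟨-, -, -, iX, iY, aq⟩ := hq
    obtain ⟨-, -, -, iA, iB, aAB⟩ := hAB
    have sy : ∀ a b, H.Adj a b → H.Adj b a := fun a b h => h.symm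
    rw [not_and_or] at h
    push Not at h
    rcases h with ⟨s, h1, h2⟩ | ⟨s, h1, h2⟩
    · constructor <;> intro a h3 h4 <;> grind
    · constructor <;> intro a h3 h4 <;> grind

/-- Main theorem: if `q` is a vertex of degree 2 in the biclique graph `G = KB(H)`,
then `G - {q}` is again a biclique graph. -/
theorem stmt_4 {V : Type} [Fintype V] (H : SimpleGraph V) (hconn : H.Connected)
    (q : {S : Set V // IsBiclique H S})
    (hdeg : ((KB H).neighborSet q).ncard = 2) :
    ∃ (W : Type) (_ : Fintype W) (H' : SimpleGraph W),
      Nonempty (KB H' ≃g SimpleGraph.induce {p | p ≠ q} (KB H)) := by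
  obtain ⟨P, R, hPR, hN⟩ := Set.ncard_eq_two.1 hdeg
  have mem : ∀ B, (KB H).Adj q B ↔ B = P ∨ B = R := by
    intro B
    have : B ∈ (KB H).neighborSet q ↔ B ∈ ({P, R} : Set _) := by rw [hN]
    simpa using this
  have hP := ((mem P).2 (Or.inl rfl)).ne
  have hR := ((mem R).2 (Or.inr rfl)).ne
  obtain ⟨X, Y, hXY, eq⟩ := q.2.1
  obtain ⟨P1, P2, hP12, eP, p1, p2⟩ := orient hXY P.2.1
  obtain ⟨R1, R2, hR12, eR, r1, r2⟩ := orient hXY R.2.1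
  have c : Cfg H X Y P1 P2 R1 R2 := by
    refine ⟨hXY, hP12, hR12, eq ▸ q.2, eP ▸ P.2, eR ▸ R.2, p1, p2, r1, r2, ?_, ?_, ?_, ?_⟩
    · rw [eP, eq]; exact fun h => hP (Subtype.ext h.symm)
    · rw [eR, eq]; exact fun h => hR (Subtype.ext h.symm)
    · rw [eP, eR]; exact fun h => hPR (Subtype.ext h)
    · intro B hB hne
      rw [eP, eq, eR]
      rw [eq] at hne
      by_cases h : B = q.1
      · exact Or.inl h
      · right
        have hadj : (KB H).Adj q ⟨B, hB⟩ := by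
          rw [KB, SimpleGraph.fromRel_adj]
          exact ⟨fun e => h (congrArg Subtype.val e).symm, Or.inr hne⟩
        rcases (mem _).1 hadj with e | e
        · exact Or.inl (congrArg Subtype.val e)
        · exact Or.inr (congrArg Subtype.val e)
  exact c.main q hconn eq.symm
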